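/- arXiv:1307.7687 — 3 statements merged into one kernel-verified Lean document; each statement's English description precedes it below -/
import Mathlib

section
/- Let p be a prime and a, b, c, d integers with 0 ≤ b ≤ a. Then the sequence e ↦ S(p^e·a + c, p^e·b + d), viewed in the p-adic integers ℤ_p, converges as e → ∞; i.e., there exists L ∈ ℤ_p such that the images of S(p^e·a + c, p^e·b + d) in ℤ_p tend to L. -/
/-- Stirling numbers of the second kind for integer arguments:
`S(n,k) = (1/k!) ∑_{i=0}^{k} (-1)^(k-i) C(k,i) i^n` for `n, k ≥ 0` (with `0^0 = 1`),
and `S(n,k) = 0` if `n < 0` or `k < 0`. -/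
def stirling2 (n k : ℤ) : ℤ :=
  if n < 0 ∨ k < 0 then 0
  else (∑ i ∈ Finset.range (k.toNat + 1),
      (-1 : ℤ) ^ (k.toNat - i) * (Nat.choose k.toNat i : ℤ) * (i : ℤ) ^ n.toNat)
    / (Nat.factorial k.toNat : ℤ)

open Finset Filter

theorem factorial_mul_stirlingSecond (n k : ℕ) :
    (k.factorial : ℤ) * Nat.stirlingSecond n k =
      ∑ i ∈ range (k + 1), (-1 : ℤ) ^ (k - i) * (k.choose i : ℤ) * (i : ℤ) ^ n := by
  induction n generalizing k with
  | zero =>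
    have h := add_pow (1 : ℤ) (-1) k
    cases k with
    | zero => simp
    | succ k => simpa [Nat.stirlingSecond] using h
  | succ n ih =>
    cases k with
    | zero => simp [Nat.stirlingSecond]
    | succ k =>
      have h1 := ih (k + 1)
      have h2 := ih k
      have key : ∑ i ∈ range (k + 1 + 1),
          (-1 : ℤ) ^ (k + 1 - i) * ((k + 1).choose i : ℤ) * (i : ℤ) ^ (n + 1) =
          (k + 1) * (∑ i ∈ range (k + 1 + 1),
            (-1 : ℤ) ^ (k + 1 - i) * ((k + 1).choose i : ℤ) * (i : ℤ) ^ n +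
          ∑ i ∈ range (k + 1), (-1 : ℤ) ^ (k - i) * (k.choose i : ℤ) * (i : ℤ) ^ n) := by
        rw [sum_range_succ _ (k + 1), sum_range_succ _ (k + 1), add_right_comm,
          ← sum_add_distrib, mul_add, mul_sum]
        congr 1
        · refine sum_congr rfl fun i hi => ?_
          obtain ⟨m, rfl⟩ := Nat.exists_eq_add_of_le (Nat.lt_succ_iff.mp (mem_range.mp hi))
          have h3 : ((i + m + 1).choose i : ℤ) * (m + 1) = (i + m).choose i * (i + m + 1) := by
            have := Nat.add_one_mul_choose_eq (i + m) m
            have e1 := Nat.choose_symm_add (a := i) (b := m)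
            have e2 := Nat.choose_symm_add (a := i) (b := m + 1)
            rw [← e1, show i + m + 1 = i + (m + 1) from rfl, ← e2] at this
            zify at this
            rw [add_assoc i m 1]
            linarith
          rw [show i + m + 1 - i = m + 1 by omega, show i + m - i = m by omega]
          push_cast
          ring_nf at h3 ⊢
          linear_combination (-1 : ℤ) ^ m * (i : ℤ) ^ n * h3
        · simp; ring
      rw [key, ← h1, ← h2, Nat.stirlingSecond_succ_succ, Nat.factorial_succ]
      push_cast
      ring

theorem stirling2_natCast (n k : ℕ) : stirling2 n k = Nat.stirlingSecond n k := by
  have hk : (k.factorial : ℤ) ≠ 0 := by exact_mod_cast k.factorial_ne_zero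
  simp only [stirling2, Int.toNat_natCast, ← factorial_mul_stirlingSecond]
  rw [if_neg (by omega), Int.mul_ediv_cancel_left _ hk]

theorem stirling2_of_neg {n k : ℤ} (h : n < 0 ∨ k < 0) : stirling2 n k = 0 := if_pos h

/-- The generating function `∑ S(m + k, k) X ^ m`. -/
noncomputable def stirlingSeries (R : Type*) [CommRing R] (k : ℕ) : PowerSeries R :=
  PowerSeries.mk fun m => (Nat.stirlingSecond (m + k) k : R)

theorem stirlingSeries_succ (R : Type*) [CommRing R] (k : ℕ) :
    stirlingSeries R (k + 1) * ((1 - Polynomial.C ((k : R) + 1) * Polynomial.X : Polynomial R) :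
      PowerSeries R) = stirlingSeries R k := by
  ext m
  push_cast
  rw [mul_sub, mul_one, mul_left_comm, map_sub, PowerSeries.coeff_C_mul]
  cases m with
  | zero => simp [stirlingSeries, Nat.stirlingSecond_self]
  | succ m =>
    rw [PowerSeries.coeff_succ_mul_X]
    simp only [stirlingSeries, PowerSeries.coeff_mk]
    rw [show m + 1 + (k + 1) = m + k + 1 + 1 by omega, Nat.stirlingSecond_succ_succ,
      show m + (k + 1) = m + k + 1 by omega, show m + 1 + k = m + k + 1 by omega]
    push_cast
    ring

theorem stirlingSeries_add (R : Type*) [CommRing R] (k l : ℕ) :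
    stirlingSeries R (k + l) * ((∏ j ∈ range l,
      (1 - Polynomial.C (((k + j : ℕ) : R) + 1) * Polynomial.X) : Polynomial R) :
      PowerSeries R) = stirlingSeries R k := by
  induction l with
  | zero => simp
  | succ l ih =>
    rw [prod_range_succ, mul_comm, Polynomial.coe_mul, mul_assoc, mul_comm _ (stirlingSeries R _),
      ← add_assoc, stirlingSeries_succ, mul_comm, ih]

theorem Function.Periodic.prod_range_shift {M : Type*} [CommMonoid M] {f : ℕ → M} {n : ℕ}
    (hf : Function.Periodic f n) (k : ℕ) :
    ∏ j ∈ range n, f (k + j) = ∏ j ∈ range n, f j := by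
  induction k with
  | zero => simp
  | succ k ih =>
    rw [← ih]
    cases n with
    | zero => simp
    | succ n =>
      rw [prod_range_succ, prod_range_succ' (fun j => f (k + j))]
      congr 1
      · exact prod_congr rfl fun j _ => congrArg f (by omega)
      · rw [show k + 1 + n = k + (n + 1) by omega, hf]; simp

theorem Function.Periodic.prod_range_mul {M : Type*} [CommMonoid M] {f : ℕ → M} {n : ℕ}
    (hf : Function.Periodic f n) (t : ℕ) :
    ∏ j ∈ range (n * t), f j = (∏ j ∈ range n, f j) ^ t := by
  induction t with
  | zero => simp
  | succ t ih => rw [mul_add, mul_one, Finset.prod_range_add, ih, hf.prod_range_shift, pow_succ]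

theorem periodic_one_sub_C_mul_X (n : ℕ) :
    Function.Periodic (fun j : ℕ => (1 - Polynomial.C ((j : ZMod n) + 1) * Polynomial.X)) n := by
  intro j
  simp

theorem stirlingSeries_add_mul (n k t : ℕ) :
    stirlingSeries (ZMod n) (k + n * t) * (((∏ j ∈ range n,
      (1 - Polynomial.C ((j : ZMod n) + 1) * Polynomial.X)) ^ t : Polynomial (ZMod n)) :
      PowerSeries (ZMod n)) = stirlingSeries (ZMod n) k := by
  have hf := periodic_one_sub_C_mul_X n
  have hg : Function.Periodic
      (fun j : ℕ => (1 - Polynomial.C (((k + j : ℕ) : ZMod n) + 1) * Polynomial.X)) n := by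
    intro j
    simp
  rw [← stirlingSeries_add (ZMod n) k (n * t), hg.prod_range_mul, hf.prod_range_shift]

theorem prod_one_sub_C_mul_X_zmod (p : ℕ) [Fact p.Prime] :
    ∏ j ∈ range p, (1 - Polynomial.C ((j : ZMod p) + 1) * Polynomial.X) =
      1 - Polynomial.X ^ (p - 1) := by
  have hp := (Fact.out : p.Prime)
  obtain ⟨q, hq⟩ : ∃ q, p = q + 1 := ⟨p - 1, by have := hp.pos; omega⟩
  have h0 : ((q : ZMod p) + 1) = 0 := by
    rw [← Nat.cast_succ, Nat.succ_eq_add_one, ← hq]; simp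
  have hr : range p = range (q + 1) := by rw [hq]
  rw [hr, prod_range_succ, h0, show p - 1 = q by omega]
  simp only [map_zero, zero_mul, sub_zero, mul_one]
  have hdeg : ∀ f : Polynomial (ZMod p), f.natDegree ≤ q → f.degree < (univ : Finset (ZMod p)).card := by
    intro f hf
    rw [card_univ, ZMod.card]
    exact lt_of_le_of_lt (Polynomial.degree_le_of_natDegree_le hf) (by exact_mod_cast (by omega))
  refine Polynomial.eq_of_degrees_lt_of_eval_finset_eq univ (hdeg _ ?_) (hdeg _ ?_) ?_
  · refine (Polynomial.natDegree_prod_le _ _).trans ?_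
    refine (sum_le_card_nsmul _ _ 1 fun j _ => ?_).trans (by simp)
    compute_degree
  · compute_degree
  · intro z _
    rw [Polynomial.eval_prod]
    simp only [Polynomial.eval_sub, Polynomial.eval_one, Polynomial.eval_mul, Polynomial.eval_C,
      Polynomial.eval_X, Polynomial.eval_pow]
    by_cases hz : z = 0
    · subst hz
      have : q ≠ 0 := by have := hp.two_le; omega
      simp [this]
    · rw [show q = p - 1 by omega, ZMod.pow_card_sub_one_eq_one hz, sub_self]
      have hv : (z⁻¹).val ≠ 0 := by
        rw [Ne, ZMod.val_eq_zero]; exact inv_ne_zero hz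
      have hlt := ZMod.val_lt (z⁻¹)
      refine prod_eq_zero (i := (z⁻¹).val - 1) (mem_range.mpr (by omega)) ?_
      rw [← Nat.cast_succ, Nat.succ_eq_add_one, Nat.sub_add_cancel (by omega), ZMod.natCast_zmod_val,
        inv_mul_cancel₀ hz, sub_self]

theorem prod_one_sub_C_mul_X_pow (p : ℕ) [Fact p.Prime] (M j : ℕ) :
    (∏ i ∈ range (p ^ (M + 1)),
      (1 - Polynomial.C ((i : ZMod (p ^ (M + 1))) + 1) * Polynomial.X)) ^ (p ^ (j + M)) =
      (1 - Polynomial.X ^ ((p - 1) * p ^ M * p ^ j)) ^ p ^ M := by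
  have h1 : (∏ i ∈ range (p ^ (M + 1)),
      (1 - Polynomial.C ((i : ZMod p) + 1) * Polynomial.X)) ^ (p ^ j) =
      1 - Polynomial.X ^ ((p - 1) * p ^ M * p ^ j) := by
    rw [pow_succ', (periodic_one_sub_C_mul_X p).prod_range_mul, prod_one_sub_C_mul_X_zmod,
      sub_pow_char_pow, sub_pow_char_pow]
    simp [pow_mul]
  set f : Polynomial ℤ := (∏ i ∈ range (p ^ (M + 1)),
      (1 - Polynomial.C ((i : ℤ) + 1) * Polynomial.X)) ^ (p ^ j) with hf
  set g : Polynomial ℤ := 1 - Polynomial.X ^ ((p - 1) * p ^ M * p ^ j) with hg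
  have hfg : (f - g).map (Int.castRingHom (ZMod p)) = 0 := by
    rw [Polynomial.map_sub, sub_eq_zero]
    simpa [hf, hg, Polynomial.map_prod] using h1
  have h2 : (p : Polynomial ℤ) ∣ f - g := by
    rw [show (p : Polynomial ℤ) = Polynomial.C (p : ℤ) by simp, Polynomial.C_dvd_iff_dvd_coeff]
    intro i
    rw [← ZMod.intCast_zmod_eq_zero_iff_dvd, ← eq_intCast (Int.castRingHom (ZMod p)),
      ← Polynomial.coeff_map, hfg, Polynomial.coeff_zero]
  obtain ⟨r, hr⟩ := dvd_sub_pow_of_dvd_sub h2 M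
  have h3 := congrArg (Polynomial.map (Int.castRingHom (ZMod (p ^ (M + 1))))) hr
  have h4 : (p : Polynomial (ZMod (p ^ (M + 1)))) ^ (M + 1) = 0 := by
    rw [← Nat.cast_pow, ← Polynomial.C_eq_natCast, ZMod.natCast_self, map_zero]
  rw [Polynomial.map_mul, Polynomial.map_pow (n := M + 1), Polynomial.map_natCast, h4, zero_mul,
    Polynomial.map_sub, sub_eq_zero] at h3
  simpa [hf, hg, Polynomial.map_prod, ← pow_mul, ← pow_add] using h3

theorem stirlingSeries_mul_pow (p : ℕ) [Fact p.Prime] (M d b j : ℕ) :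
    stirlingSeries (ZMod (p ^ (M + 1))) (p ^ (j + (2 * M + 1)) * b + d) *
      (1 - PowerSeries.X ^ ((p - 1) * p ^ M * p ^ j)) ^ (p ^ M * b) =
      stirlingSeries (ZMod (p ^ (M + 1))) d := by
  have h := stirlingSeries_add_mul (p ^ (M + 1)) d (p ^ (j + M) * b)
  rw [pow_mul, prod_one_sub_C_mul_X_pow, ← pow_mul] at h
  rw [← h, show d + p ^ (M + 1) * (p ^ (j + M) * b) = p ^ (j + (2 * M + 1)) * b + d by ring]
  simp

/-- The coefficient of a power series at an integer exponent, zero at negative exponents. -/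
noncomputable def intCoeff {R : Type*} [CommRing R] (V : PowerSeries R) (m : ℤ) : R :=
  if 0 ≤ m then PowerSeries.coeff m.toNat V else 0

theorem intCoeff_of_neg {R : Type*} [CommRing R] (V : PowerSeries R) {m : ℤ} (hm : m < 0) :
    intCoeff V m = 0 := if_neg (not_le.mpr hm)

theorem intCoeff_mul_one_sub_X_pow {R : Type*} [CommRing R] (V : PowerSeries R) (r : ℕ) (m : ℤ) :
    intCoeff (V * (1 - PowerSeries.X ^ r)) m = intCoeff V m - intCoeff V (m - r) := by
  unfold intCoeff
  by_cases hm : 0 ≤ m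
  · obtain ⟨m, rfl⟩ := Int.eq_ofNat_of_zero_le hm
    rw [mul_sub, mul_one, map_sub, PowerSeries.coeff_mul_X_pow']
    by_cases hr : r ≤ m
    · have h1 : (0 : ℤ) ≤ m - r := by omega
      have h2 : ((m : ℤ) - r).toNat = m - r := by omega
      simp [hr, h2]
    · have h1 : ¬ (0 : ℤ) ≤ m - r := by omega
      simp [hr]
  · rw [if_neg hm, if_neg hm, if_neg (by omega), sub_zero]

theorem intCoeff_stirlingSeries (R : Type*) [CommRing R] (n : ℤ) (k : ℕ) :
    intCoeff (stirlingSeries R k) (n - k) = (stirling2 n k : R) := by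
  by_cases hn : n < 0
  · rw [intCoeff_of_neg _ (by omega), stirling2_of_neg (Or.inl hn), Int.cast_zero]
  · obtain ⟨n, rfl⟩ := Int.eq_ofNat_of_zero_le (not_lt.mp hn)
    rw [stirling2_natCast, Int.cast_natCast]
    by_cases h : k ≤ n
    · rw [intCoeff, if_pos (by omega), stirlingSeries, PowerSeries.coeff_mk]
      congr 2
      omega
    · rw [intCoeff_of_neg _ (by omega), Nat.stirlingSecond_eq_zero_of_lt (by omega), Nat.cast_zero]

theorem tendsto_pow_mul_add_atTop {p : ℕ} (hp : 1 < p) {s : ℤ} (hs : 0 < s) (γ : ℤ) :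
    Tendsto (fun j : ℕ => (p : ℤ) ^ j * s + γ) atTop atTop :=
  tendsto_atTop_add_const_right _ _
    ((tendsto_pow_atTop_atTop_of_one_lt (by exact_mod_cast hp)).atTop_mul_const' hs)

theorem eventually_pow_mul_add_neg {p : ℕ} (hp : 1 < p) {s : ℤ} (hs : s < 0) (γ : ℤ) :
    ∀ᶠ j : ℕ in atTop, (p : ℤ) ^ j * s + γ < 0 := by
  filter_upwards [(tendsto_pow_mul_add_atTop hp (neg_pos.mpr hs) (-γ)).eventually_gt_atTop 0]
    with j hj
  linarith

/-- Eventual constancy of coefficients along `p ^ j * s + γ` survives division by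
`1 - X ^ (u * p ^ j)`. -/
theorem eventually_intCoeff_of_mul {R : Type*} [CommRing R] {p u : ℕ} (hp : 1 < p) (hu : 0 < u)
    {V : ℕ → PowerSeries R} (γ : ℤ)
    (h : ∀ s : ℤ, ∃ x, ∀ᶠ j : ℕ in atTop,
      intCoeff (V j * (1 - PowerSeries.X ^ (u * p ^ j))) ((p : ℤ) ^ j * s + γ) = x) (s : ℤ) :
    ∃ x, ∀ᶠ j : ℕ in atTop, intCoeff (V j) ((p : ℤ) ^ j * s + γ) = x := by
  by_cases hs : s < 0
  · exact ⟨0, (eventually_pow_mul_add_neg hp hs γ).mono fun j hj => intCoeff_of_neg _ hj⟩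
  · obtain ⟨x, hx⟩ := h s
    obtain ⟨y, hy⟩ := eventually_intCoeff_of_mul hp hu γ h (s - u)
    refine ⟨x + y, ?_⟩
    filter_upwards [hx, hy] with j hxj hyj
    rw [intCoeff_mul_one_sub_X_pow] at hxj
    rw [← hxj, ← hyj]
    push_cast
    ring_nf
  termination_by (s + 1).toNat
  decreasing_by omega

theorem eventually_intCoeff_of_mul_pow {R : Type*} [CommRing R] {p u : ℕ} (hp : 1 < p)
    (hu : 0 < u) (r : ℕ) {V : ℕ → PowerSeries R} (γ : ℤ)
    (h : ∀ s : ℤ, ∃ x, ∀ᶠ j : ℕ in atTop,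
      intCoeff (V j * (1 - PowerSeries.X ^ (u * p ^ j)) ^ r) ((p : ℤ) ^ j * s + γ) = x) (s : ℤ) :
    ∃ x, ∀ᶠ j : ℕ in atTop, intCoeff (V j) ((p : ℤ) ^ j * s + γ) = x := by
  induction r generalizing V s with
  | zero => simpa using h s
  | succ r ih =>
    refine eventually_intCoeff_of_mul hp hu γ (fun s => ih (fun s => ?_) s) s
    simpa only [mul_assoc, ← pow_succ'] using h s

theorem ZMod.pow_add_totient_mul {p : ℕ} [hp : Fact p.Prime] (K : ℕ) (x : ℕ) {n : ℕ} (hn : K ≤ n)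
    (t : ℕ) : (x : ZMod (p ^ K)) ^ (n + (p ^ K).totient * t) = (x : ZMod (p ^ K)) ^ n := by
  by_cases hx : p ∣ x
  · have h : ∀ m, K ≤ m → (x : ZMod (p ^ K)) ^ m = 0 := fun m hm => by
      rw [← Nat.cast_pow, ZMod.natCast_eq_zero_iff]
      exact (pow_dvd_pow p hm).trans (pow_dvd_pow_of_dvd hx m)
    rw [h _ hn, h _ (by omega)]
  · have hc : x.Coprime (p ^ K) := (((Nat.Prime.coprime_iff_not_dvd hp.out).2 hx).symm).pow_right K
    have h1 : (x : ZMod (p ^ K)) ^ (p ^ K).totient = 1 := by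
      have := (ZMod.natCast_eq_natCast_iff _ _ _).2 (Nat.ModEq.pow_totient hc)
      simpa using this
    rw [pow_add, pow_mul, h1, one_pow, mul_one]

theorem stirlingSecond_add_totient_mul {p : ℕ} [hp : Fact p.Prime] (M d : ℕ) :
    ∃ K, ∀ n t, K ≤ n → (Nat.stirlingSecond (n + (p ^ K).totient * t) d : ZMod (p ^ M)) =
      Nat.stirlingSecond n d := by
  obtain ⟨v, w, hw, hd⟩ := Nat.exists_eq_pow_mul_and_not_dvd d.factorial_ne_zero p hp.out.ne_one
  refine ⟨M + v, fun n t hn => ?_⟩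
  have h1 : ((d.factorial * Nat.stirlingSecond (n + (p ^ (M + v)).totient * t) d : ℤ) :
      ZMod (p ^ (M + v))) = ((d.factorial * Nat.stirlingSecond n d : ℤ) : ZMod (p ^ (M + v))) := by
    rw [factorial_mul_stirlingSecond, factorial_mul_stirlingSecond]
    push_cast
    exact sum_congr rfl fun i _ => by rw [ZMod.pow_add_totient_mul _ _ hn]
  rw [ZMod.intCast_eq_intCast_iff_dvd_sub, ← mul_sub, hd] at h1
  rw [← Int.cast_natCast, ← Int.cast_natCast (Nat.stirlingSecond n d),
    ZMod.intCast_eq_intCast_iff_dvd_sub]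
  have hp0 : (p : ℤ) ^ v ≠ 0 := pow_ne_zero _ (by exact_mod_cast hp.out.ne_zero)
  push_cast at h1 ⊢
  rw [pow_add, mul_comm ((p : ℤ) ^ M), mul_assoc] at h1
  refine IsCoprime.dvd_of_dvd_mul_left ?_ (Int.dvd_of_mul_dvd_mul_left hp0 h1)
  exact (Nat.isCoprime_iff_coprime.2 ((Nat.Prime.coprime_iff_not_dvd hp.out).2 hw)).pow_left

theorem exists_eventually_eq_of_eventually_succ {α : Type*} {f : ℕ → α}
    (h : ∀ᶠ j in atTop, f (j + 1) = f j) : ∃ x, ∀ᶠ j in atTop, f j = x := by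
  obtain ⟨N, hN⟩ := eventually_atTop.1 h
  refine ⟨f N, eventually_atTop.2 ⟨N, fun j hj => ?_⟩⟩
  induction j, hj using Nat.le_induction with
  | base => rfl
  | succ j hj ih => rw [hN j hj, ih]

theorem eventually_intCoeff_stirlingSeries (p : ℕ) [hp : Fact p.Prime] (M d : ℕ) (γ s : ℤ) :
    ∃ x, ∀ᶠ j : ℕ in atTop,
      intCoeff (stirlingSeries (ZMod (p ^ M)) d) ((p : ℤ) ^ j * s + γ) = x := by
  rcases lt_trichotomy s 0 with hs | rfl | hs
  · exact ⟨0, (eventually_pow_mul_add_neg hp.out.one_lt hs γ).mono fun j hj =>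
      intCoeff_of_neg _ hj⟩
  · exact ⟨_, Eventually.of_forall fun j => by rw [mul_zero]⟩
  · obtain ⟨K, hK⟩ := stirlingSecond_add_totient_mul (p := p) M d
    refine exists_eventually_eq_of_eventually_succ ?_
    filter_upwards [(tendsto_pow_mul_add_atTop hp.out.one_lt hs γ).eventually_ge_atTop (K : ℤ),
      eventually_ge_atTop K] with j hj hjK
    obtain ⟨s, rfl⟩ := Int.eq_ofNat_of_zero_le hs.le
    obtain ⟨m, hm⟩ := Int.eq_ofNat_of_zero_le (hj.trans' (Int.natCast_nonneg K))
    obtain ⟨t, ht⟩ : (p ^ K).totient ∣ p ^ j * (p - 1) * s := by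
      refine Dvd.dvd.mul_right ?_ s
      rw [← Nat.totient_prime_pow_succ hp.out]
      exact Nat.totient_dvd_of_dvd (pow_dvd_pow p (by omega))
    have hm' : (p : ℤ) ^ (j + 1) * s + γ = (m + (p ^ K).totient * t : ℕ) := by
      rw [← ht]
      push_cast [Nat.cast_sub hp.out.one_le]
      rw [← hm]
      ring
    rw [hm, hm']
    simp only [intCoeff, Int.natCast_nonneg, if_true, Int.toNat_natCast, stirlingSeries,
      PowerSeries.coeff_mk]
    rw [show m + (p ^ K).totient * t + d = m + d + (p ^ K).totient * t by omega]
    exact hK _ _ (by omega)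

theorem eventually_stirling2_natCast (p : ℕ) [hp : Fact p.Prime] (M : ℕ) (a c : ℤ) (b d : ℕ) :
    ∃ x : ZMod (p ^ (M + 1)), ∀ᶠ e : ℕ in atTop,
      (stirling2 ((p : ℤ) ^ e * a + c) ((p : ℤ) ^ e * b + d) : ZMod (p ^ (M + 1))) = x := by
  have h := eventually_intCoeff_of_mul_pow (R := ZMod (p ^ (M + 1))) (u := (p - 1) * p ^ M)
    (V := fun j => stirlingSeries _ (p ^ (j + (2 * M + 1)) * b + d)) hp.out.one_lt
    (Nat.mul_pos (Nat.sub_pos_of_lt hp.out.one_lt) (pow_pos hp.out.pos M)) (p ^ M * b) (c - d)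
    (fun s => by
      simp only [stirlingSeries_mul_pow]
      exact eventually_intCoeff_stirlingSeries p (M + 1) d (c - d) s)
    ((p : ℤ) ^ (2 * M + 1) * (a - b))
  obtain ⟨x, hx⟩ := h
  refine ⟨x, ?_⟩
  rw [← map_add_atTop_eq_nat (2 * M + 1), eventually_map]
  filter_upwards [hx] with j hj
  rw [← hj]
  have := intCoeff_stirlingSeries (ZMod (p ^ (M + 1))) ((p : ℤ) ^ (j + (2 * M + 1)) * a + c)
    (p ^ (j + (2 * M + 1)) * b + d)
  push_cast at this
  rw [← this]
  congr 1
  ring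

theorem PadicInt.exists_tendsto_intCast {p : ℕ} [hp : Fact p.Prime] {f : ℕ → ℤ}
    (h : ∀ M : ℕ, ∃ x : ZMod (p ^ (M + 1)), ∀ᶠ e in atTop, (f e : ZMod (p ^ (M + 1))) = x) :
    ∃ L : ℤ_[p], Tendsto (fun e => (f e : ℤ_[p])) atTop (nhds L) := by
  refine cauchySeq_tendsto_of_complete (Metric.cauchySeq_iff'.2 fun ε hε => ?_)
  obtain ⟨M, hM⟩ := PadicInt.exists_pow_neg_lt p hε
  obtain ⟨x, hx⟩ := h M
  obtain ⟨N, hN⟩ := eventually_atTop.1 hx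
  refine ⟨N, fun n hn => lt_of_le_of_lt ?_ hM⟩
  have hd := (ZMod.intCast_eq_intCast_iff_dvd_sub _ _ _).1 ((hN N le_rfl).trans (hN n hn).symm)
  rw [dist_eq_norm, ← Int.cast_sub, PadicInt.norm_int_le_pow_iff_dvd]
  exact (pow_dvd_pow (p : ℤ) M.le_succ).trans (by exact_mod_cast hd)

theorem stirling2_eq_sub (n : ℤ) {k : ℤ} (hk : 0 ≤ k) :
    stirling2 n k = stirling2 (n + 1) (k + 1) - (k + 1) * stirling2 n (k + 1) := by
  obtain ⟨k, rfl⟩ := Int.eq_ofNat_of_zero_le hk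
  rcases lt_trichotomy n (-1) with hn | rfl | hn
  · simp [stirling2_of_neg (k := k) (Or.inl (show n < 0 by omega)),
      stirling2_of_neg (k := k + 1) (Or.inl (show n < 0 by omega)),
      stirling2_of_neg (k := k + 1) (Or.inl (show n + 1 < 0 by omega))]
  · rw [stirling2_of_neg (by omega), stirling2_of_neg (n := -1) (by omega)]
    have := stirling2_natCast 0 (k + 1)
    rw [Nat.stirlingSecond_zero_succ] at this
    push_cast at this
    simp [this]
  · obtain ⟨n, rfl⟩ := Int.eq_ofNat_of_zero_le (show 0 ≤ n by omega)
    have h1 := stirling2_natCast (n + 1) (k + 1)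
    have h2 := stirling2_natCast n (k + 1)
    push_cast at h1 h2
    rw [h1, h2, stirling2_natCast, Nat.stirlingSecond_succ_succ]
    push_cast
    ring

theorem PadicInt.tendsto_pow_mul_add {p : ℕ} [hp : Fact p.Prime] (b d : ℤ) :
    Tendsto (fun e : ℕ => (((p : ℤ) ^ e * b + d : ℤ) : ℤ_[p])) atTop (nhds (d : ℤ_[p])) := by
  have h : Tendsto (fun e : ℕ => (p : ℤ_[p]) ^ e) atTop (nhds 0) :=
    tendsto_pow_atTop_nhds_zero_of_norm_lt_one (by
      rw [PadicInt.norm_p]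
      exact inv_lt_one_of_one_lt₀ (by exact_mod_cast hp.out.one_lt))
  simpa using (h.mul_const (b : ℤ_[p])).add_const (d : ℤ_[p])

theorem padic_limit_stirling2_exists (p : ℕ) [Fact p.Prime] (a b c d : ℤ)
    (hb : 0 ≤ b) (hba : b ≤ a) :
    ∃ L : ℤ_[p], Filter.Tendsto
      (fun e : ℕ => ((stirling2 ((p : ℤ) ^ e * a + c) ((p : ℤ) ^ e * b + d) : ℤ) : ℤ_[p]))
      Filter.atTop (nhds L) := by
  have hp := (Fact.out : p.Prime)
  by_cases hd : 0 ≤ d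
  · obtain ⟨b, rfl⟩ := Int.eq_ofNat_of_zero_le hb
    obtain ⟨d, rfl⟩ := Int.eq_ofNat_of_zero_le hd
    exact PadicInt.exists_tendsto_intCast fun M => eventually_stirling2_natCast p M a c b d
  · rcases hb.eq_or_lt with rfl | hb'
    · exact ⟨0, tendsto_const_nhds.congr fun e => by rw [stirling2_of_neg (by simp; omega)]; simp⟩
    · obtain ⟨L₁, h₁⟩ := padic_limit_stirling2_exists p a b (c + 1) (d + 1) hb hba
      obtain ⟨L₂, h₂⟩ := padic_limit_stirling2_exists p a b c (d + 1) hb hba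
      refine ⟨L₁ - (d + 1 : ℤ) * L₂, ?_⟩
      refine (h₁.sub ((PadicInt.tendsto_pow_mul_add b (d + 1)).mul h₂)).congr' ?_
      filter_upwards [(tendsto_pow_mul_add_atTop hp.one_lt hb' d).eventually_ge_atTop 0] with e he
      rw [stirling2_eq_sub _ he]
      simp only [← add_assoc]
      push_cast
      ring
  termination_by (-d).toNat
  decreasing_by all_goals omega
end

section
/- Let p be a prime and k, d positive integers. Then ν_p( T_p((p−1)k + d − 1, d) − T_p(d−1, d) ) ≥ ν_p(k) − ⌊log_p(d)⌋. -/
/-- Partial Stirling numbers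
`T_p(n,k) = ((-1)^k/k!) ∑_{0 ≤ i ≤ k, p ∤ i} (-1)^i C(k,i) i^n`. -/
def partialStirling (p : ℕ) (n k : ℕ) : ℚ :=
  ((-1 : ℚ) ^ k / (Nat.factorial k : ℚ)) *
    ∑ i ∈ Finset.range (k + 1),
      if ¬ (p ∣ i) then (-1 : ℚ) ^ i * (Nat.choose k i : ℚ) * (i : ℚ) ^ n else 0

open Finset Polynomial in
theorem factorial_dvd_sum_neg_one_pow_mul_choose_mul_eval (d : ℕ) (P : ℤ[X]) :
    (d.factorial : ℤ) ∣ ∑ i ∈ range (d + 1), (-1 : ℤ) ^ i * (d.choose i : ℤ) * P.eval (i : ℤ) := by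
  induction d generalizing P with
  | zero => simp
  | succ d ih =>
    have hconst : ∑ i ∈ range (d + 2), (-1 : ℤ) ^ i * ((d + 1).choose i : ℤ) = 0 := by
      have := Int.alternating_sum_range_choose (n := d + 1)
      simpa using this
    have key : ∑ i ∈ range (d + 1 + 1),
          (-1 : ℤ) ^ i * ((d + 1).choose i : ℤ) * P.eval (i : ℤ) =
        ((d : ℤ) + 1) * -∑ i ∈ range (d + 1),
          (-1 : ℤ) ^ i * (d.choose i : ℤ) * (P.divX.comp (X + 1)).eval (i : ℤ) := by
      have hP (i : ℕ) : P.eval (i : ℤ) = P.divX.eval (i : ℤ) * i + P.coeff 0 := by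
        conv_lhs => rw [← divX_mul_X_add P]
        simp
      simp_rw [hP, mul_add, sum_add_distrib]
      rw [← sum_mul, hconst, zero_mul, add_zero, sum_range_succ', ← sum_neg_distrib, mul_sum]
      simp only [Nat.cast_zero, mul_zero, add_zero]
      refine sum_congr rfl fun i _ => ?_
      have hc : ((d : ℤ) + 1) * d.choose i = (d + 1).choose (i + 1) * (i + 1) := by
        exact_mod_cast Nat.add_one_mul_choose_eq d i
      simp only [eval_comp, eval_add, eval_X, eval_one, Nat.cast_add, Nat.cast_one, pow_succ]
      linear_combination (-1 : ℤ) ^ i * P.divX.eval ((i : ℤ) + 1) * hc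
    rw [key, Nat.factorial_succ]
    push_cast
    exact mul_dvd_mul_left _ (ih _).neg_right

theorem pow_padicValNat_dvd_pow_padicValNat_mul_choose (p : ℕ) [Fact p.Prime] {k j : ℕ}
    (hj : j ≠ 0) : p ^ padicValNat p k ∣ p ^ padicValNat p j * k.choose j := by
  rcases Nat.eq_zero_or_pos k with rfl | hk
  · simp [Nat.choose_eq_zero_of_lt (Nat.pos_of_ne_zero hj)]
  obtain ⟨m, hm⟩ := pow_padicValNat_dvd (p := p) (n := j)
  have hpm : ¬ p ∣ m := by
    rintro ⟨c, rfl⟩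
    refine pow_succ_padicValNat_not_dvd (p := p) hj ⟨c, ?_⟩
    rw [pow_succ, mul_assoc, ← hm]
  have hcop : Nat.Coprime (p ^ padicValNat p k) m :=
    (((Fact.out : p.Prime).coprime_iff_not_dvd).2 hpm).pow_left _
  refine hcop.dvd_of_dvd_mul_left (pow_padicValNat_dvd.trans ?_)
  obtain ⟨k, rfl⟩ := Nat.exists_eq_succ_of_ne_zero hk.ne'
  obtain ⟨i, rfl⟩ := Nat.exists_eq_succ_of_ne_zero hj
  refine ⟨k.choose i, ?_⟩
  rw [← mul_assoc, mul_comm m, ← hm, mul_comm]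
  exact (Nat.add_one_mul_choose_eq k i).symm

/-- Alternating binomial sum over the indices prime to `p` of `i ^ (d - 1) * (i ^ (p - 1) - 1) ^ j`. -/
def unitAlternatingSum (p d j : ℕ) : ℤ :=
  ∑ i ∈ Finset.range (d + 1),
    if ¬ (p ∣ i) then
      (-1 : ℤ) ^ i * (d.choose i : ℤ) * ((i : ℤ) ^ (d - 1) * ((i : ℤ) ^ (p - 1) - 1) ^ j) else 0

theorem pow_dvd_unitAlternatingSum (p : ℕ) [Fact p.Prime] (d j : ℕ) :
    (p : ℤ) ^ j ∣ unitAlternatingSum p d j := by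
  refine Finset.dvd_sum fun i _ => ?_
  split_ifs with h
  · exact dvd_zero _
  refine Dvd.dvd.mul_left (Dvd.dvd.mul_left (pow_dvd_pow_of_dvd ?_ j) _) _
  have hcop : IsCoprime (i : ℤ) (p : ℤ) :=
    Nat.isCoprime_iff_coprime.2 (((Fact.out : p.Prime).coprime_iff_not_dvd).2 h).symm
  exact (Int.ModEq.pow_card_sub_one_eq_one Fact.out hcop).symm.dvd

theorem pow_padicValNat_factorial_dvd_unitAlternatingSum (p : ℕ) [Fact p.Prime] {d : ℕ}
    (hd : d ≠ 0) (j : ℕ) :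
    (p : ℤ) ^ padicValNat p d.factorial ∣ unitAlternatingSum p d j := by
  let P : Polynomial ℤ := Polynomial.X ^ (d - 1) * (Polynomial.X ^ (p - 1) - 1) ^ j
  have hsplit : unitAlternatingSum p d j =
      (∑ i ∈ Finset.range (d + 1), (-1 : ℤ) ^ i * (d.choose i : ℤ) * P.eval (i : ℤ)) -
      ∑ i ∈ Finset.range (d + 1),
        if p ∣ i then (-1 : ℤ) ^ i * (d.choose i : ℤ) * P.eval (i : ℤ) else 0 := by
    rw [unitAlternatingSum, ← Finset.sum_sub_distrib]
    refine Finset.sum_congr rfl fun i _ => ?_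
    by_cases h : p ∣ i <;> simp [h, P]
  rw [hsplit]
  refine dvd_sub ?_ (Finset.dvd_sum fun i _ => ?_)
  · refine dvd_trans ?_ (factorial_dvd_sum_neg_one_pow_mul_choose_mul_eval d P)
    exact_mod_cast pow_padicValNat_dvd
  · split_ifs with h
    · have hle : padicValNat p d.factorial ≤ d - 1 :=
        Nat.le_sub_one_of_lt (padicValNat_factorial_lt_of_ne_zero p hd)
      have hi : (p : ℤ) ^ padicValNat p d.factorial ∣ (i : ℤ) ^ (d - 1) :=
        (pow_dvd_pow _ hle).trans (pow_dvd_pow_of_dvd (Int.natCast_dvd_natCast.2 h) _)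
      simp only [P, Polynomial.eval_mul, Polynomial.eval_pow, Polynomial.eval_X]
      exact (hi.mul_right _).mul_left _
    · exact dvd_zero _

theorem padicValNat_add_padicValNat_factorial_le (p : ℕ) [Fact p.Prime] {d j : ℕ}
    (hd : d ≠ 0) (hj : j ≠ 0) (h : Nat.log p d < padicValNat p j) :
    padicValNat p j + padicValNat p d.factorial ≤ j + Nat.log p d := by
  have hp : 1 < p := (Fact.out : p.Prime).one_lt
  have hfac := padicValNat_factorial_lt_of_ne_zero p hd
  have hlog : d < p ^ (Nat.log p d + 1) := Nat.lt_pow_succ_log_self hp d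
  have hpj : p ^ padicValNat p j ≤ j :=
    Nat.le_of_dvd (Nat.pos_of_ne_zero hj) pow_padicValNat_dvd
  obtain ⟨c, hc⟩ := Nat.exists_eq_add_of_le (Nat.succ_le_of_lt h)
  have hpc : c < p ^ c := Nat.lt_pow_self hp
  rw [hc, Nat.succ_eq_add_one, pow_add] at hpj
  rw [hc, Nat.succ_eq_add_one]
  nlinarith [Nat.mul_le_mul_left (p ^ (Nat.log p d + 1)) (Nat.succ_le_of_lt hpc)]

theorem pow_dvd_pow_log_mul_choose_mul_unitAlternatingSum (p : ℕ) [Fact p.Prime] (k : ℕ)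
    {d j : ℕ} (hd : d ≠ 0) (hj : j ≠ 0) :
    (p : ℤ) ^ (padicValNat p k + padicValNat p d.factorial) ∣
      (p : ℤ) ^ Nat.log p d * (k.choose j * unitAlternatingSum p d j) := by
  have hchoose : (p : ℤ) ^ padicValNat p k ∣ (p : ℤ) ^ padicValNat p j * k.choose j :=
    mod_cast pow_padicValNat_dvd_pow_padicValNat_mul_choose p (k := k) hj
  have hsum : (p : ℤ) ^ (padicValNat p j + padicValNat p d.factorial) ∣
      (p : ℤ) ^ Nat.log p d * unitAlternatingSum p d j := by
    rcases le_or_gt (padicValNat p j) (Nat.log p d) with h | h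
    · rw [pow_add]
      exact mul_dvd_mul (pow_dvd_pow _ h) (pow_padicValNat_factorial_dvd_unitAlternatingSum p hd j)
    · refine (pow_dvd_pow _ (padicValNat_add_padicValNat_factorial_le p hd hj h)).trans ?_
      rw [add_comm, pow_add]
      exact mul_dvd_mul_left _ (pow_dvd_unitAlternatingSum p d j)
  have hp : (p : ℤ) ^ padicValNat p j ≠ 0 :=
    pow_ne_zero _ (Nat.cast_ne_zero.2 (Fact.out : p.Prime).ne_zero)
  refine (mul_dvd_mul_iff_left hp).1 ?_
  convert mul_dvd_mul hchoose hsum using 1 <;> ring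

theorem partialStirling_sub_eq (p k : ℕ) {d : ℕ} (hd : 1 ≤ d) :
    partialStirling p ((p - 1) * k + d - 1) d - partialStirling p (d - 1) d =
      ((-1 : ℚ) ^ d / (d.factorial : ℚ)) *
        ((∑ j ∈ Finset.range k,
          (k.choose (j + 1) * unitAlternatingSum p d (j + 1)) : ℤ) : ℚ) := by
  have hpow (x : ℤ) : x ^ ((p - 1) * k + d - 1) - x ^ (d - 1) =
      ∑ j ∈ Finset.range k,
        (k.choose (j + 1) : ℤ) * (x ^ (d - 1) * (x ^ (p - 1) - 1) ^ (j + 1)) := by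
    have hbinom : x ^ ((p - 1) * k) = ∑ j ∈ Finset.range (k + 1),
        (x ^ (p - 1) - 1) ^ j * (k.choose j : ℤ) := by
      rw [pow_mul]
      conv_lhs => rw [← sub_add_cancel (x ^ (p - 1)) 1, add_pow]
      simp
    rw [Nat.add_sub_assoc hd, pow_add, hbinom, Finset.sum_range_succ', add_mul, Finset.sum_mul]
    simp only [pow_zero, Nat.choose_zero_right, Nat.cast_one, one_mul, mul_one,
      add_sub_cancel_right]
    exact Finset.sum_congr rfl fun j _ => by ring
  rw [partialStirling, partialStirling, ← mul_sub, ← Finset.sum_sub_distrib]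
  congr 1
  simp_rw [unitAlternatingSum, Finset.mul_sum]
  rw [Finset.sum_comm]
  push_cast
  refine Finset.sum_congr rfl fun i _ => ?_
  by_cases h : p ∣ i
  · simp [h]
  · have hi := congrArg (Int.cast : ℤ → ℚ) (hpow i)
    push_cast at hi
    simp only [h, not_false_eq_true, if_true]
    rw [← mul_sub, hi, Finset.mul_sum]
    exact Finset.sum_congr rfl fun j _ => by ring

theorem padicValRat_partialStirling_diff (p : ℕ) [Fact p.Prime] (k d : ℕ)
    (hk : 1 ≤ k) (hd : 1 ≤ d) :
    partialStirling p ((p - 1) * k + d - 1) d - partialStirling p (d - 1) d = 0 ∨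
    (padicValNat p k : ℤ) - (Nat.log p d : ℤ) ≤
      padicValRat p (partialStirling p ((p - 1) * k + d - 1) d - partialStirling p (d - 1) d) := by
  rw [partialStirling_sub_eq p k hd]
  set D : ℤ := ∑ j ∈ Finset.range k, (k.choose (j + 1) * unitAlternatingSum p d (j + 1)) with hD
  by_cases hD0 : D = 0
  · simp [hD0]
  right
  have hdvd : (p : ℤ) ^ (padicValNat p k + padicValNat p d.factorial) ∣
      (p : ℤ) ^ Nat.log p d * D := by
    rw [hD, Finset.mul_sum]
    exact Finset.dvd_sum fun j _ =>
      pow_dvd_pow_log_mul_choose_mul_unitAlternatingSum p k (by lia) j.succ_ne_zero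
  have hp0 : (p : ℤ) ≠ 0 := Nat.cast_ne_zero.2 (Fact.out : p.Prime).ne_zero
  have hval := ((padicValInt_dvd_iff _ _).1 hdvd).resolve_left
    (mul_ne_zero (pow_ne_zero _ hp0) hD0)
  rw [padicValInt.mul (pow_ne_zero _ hp0) hD0] at hval
  have hppow : padicValInt p ((p : ℤ) ^ Nat.log p d) = Nat.log p d := by
    rw [← Nat.cast_pow, padicValInt.of_nat, padicValNat.prime_pow]
  have hfac : (d.factorial : ℚ) ≠ 0 := Nat.cast_ne_zero.2 d.factorial_ne_zero
  have hone : padicValRat p ((-1 : ℚ) ^ d) = 0 := by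
    rcases neg_one_pow_eq_or ℚ d with h | h <;> simp [h]
  rw [padicValRat.mul (div_ne_zero (pow_ne_zero _ (by norm_num)) hfac) (Int.cast_ne_zero.2 hD0),
    padicValRat.div (pow_ne_zero _ (by norm_num)) hfac, hone, padicValRat.of_nat,
    padicValRat.of_int]
  lia
end

section
/- Let p be a prime, a, b integers with 1 ≤ b ≤ a and a ≡ b (mod p−1), and c, d integers with d ≥ 1 and c ≥ d − 1. Then, in ℚ_p, the limit as e → ∞ of S(p^e·a + c, p^e·b + d) equals (limit as e → ∞ of S(p^e·a, p^e·b)) · ( S(c,d) + Σ_{i=1}^{d} S_i(c,d)·T_p(i−1,i)·(p/(p−1))·((a−b)/b) ), where both limits exist in ℤ_p ⊆ ℚ_p and the rational numbers are viewed in ℚ_p. -/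
/-- Stirling-like numbers `S_i(c,d)` (for `i ≥ 1`): `S_i(i-1,i) = 1`;
`S_i(c,d) = 0` whenever `d < i` or `d < 0`, and also whenever `c ≤ d-1` with
`(c,d) ≠ (i-1,i)`; and `S_i(c,d) = d·S_i(c-1,d) + S_i(c-1,d-1)` whenever `c ≥ d ≥ 0`.
(Since `S_i(c,d) = 0` for every `c < 0`, the first argument is taken in `ℕ`.) -/
def stirlingLike (i : ℕ) : ℕ → ℤ → ℤ
  | 0, d =>
      if (0 : ℤ) ≤ d - 1 then (if ((0 : ℤ) = (i : ℤ) - 1 ∧ d = (i : ℤ)) then 1 else 0)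
      else 0
  | c + 1, d =>
      if ((c : ℤ) + 1) ≤ d - 1 then
        (if ((c : ℤ) + 1 = (i : ℤ) - 1 ∧ d = (i : ℤ)) then 1 else 0)
      else if d < 0 then 0
      else d * stirlingLike i c d + stirlingLike i c (d - 1)

section

open Finset PowerSeries

namespace PadicStirling

/-- The explicit formula for Stirling numbers of the second kind, cleared of denominators. -/
theorem sum_choose_mul_pow_eq (n k : ℕ) :
    ∑ i ∈ range (k + 1), (-1 : ℤ) ^ i * (k.choose i : ℤ) * (i : ℤ) ^ n =
      (-1) ^ k * k.factorial * Nat.stirlingSecond n k := by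
  induction n generalizing k with
  | zero =>
    cases k with
    | zero => simp
    | succ k => simpa using Int.alternating_sum_range_choose_of_ne (Nat.succ_ne_zero k)
  | succ n ih =>
    cases k with
    | zero => simp
    | succ k =>
      have hchoose : ∀ i : ℕ, ((k + 1).choose i : ℤ) * i =
          (k + 1) * ((k + 1).choose i - k.choose i) := by
        intro i
        cases i with
        | zero => simp
        | succ i =>
          have h1 := Nat.add_one_mul_choose_eq k i
          have h2 := Nat.choose_succ_succ k i
          zify at h1 h2
          simp only [Nat.succ_eq_add_one] at h2
          push_cast
          rw [← h1, h2]
          ring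
      have hext : ∑ i ∈ range (k + 1 + 1), (-1 : ℤ) ^ i * (k.choose i : ℤ) * (i : ℤ) ^ n =
          (-1) ^ k * k.factorial * Nat.stirlingSecond n k := by
        rw [sum_range_succ, ih]
        simp
      have hsplit : ∑ i ∈ range (k + 1 + 1),
          (-1 : ℤ) ^ i * ((k + 1).choose i : ℤ) * (i : ℤ) ^ (n + 1) =
          (k + 1) * (∑ i ∈ range (k + 1 + 1),
            (-1 : ℤ) ^ i * ((k + 1).choose i : ℤ) * (i : ℤ) ^ n -
          ∑ i ∈ range (k + 1 + 1), (-1 : ℤ) ^ i * (k.choose i : ℤ) * (i : ℤ) ^ n) := by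
        rw [← sum_sub_distrib, mul_sum]
        refine sum_congr rfl fun i _ => ?_
        linear_combination (-1 : ℤ) ^ i * (i : ℤ) ^ n * hchoose i
      rw [hsplit, ih, hext, Nat.stirlingSecond_succ_succ, Nat.factorial_succ]
      push_cast
      ring

theorem neg_one_pow_sub_eq {i k : ℕ} (h : i ≤ k) : (-1 : ℤ) ^ (k - i) = (-1) ^ k * (-1) ^ i := by
  obtain ⟨j, rfl⟩ := Nat.exists_eq_add_of_le h
  rw [Nat.add_sub_cancel_left, pow_add, mul_right_comm, ← mul_pow]
  simp

theorem stirling2_natCast (n k : ℕ) : stirling2 n k = Nat.stirlingSecond n k := by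
  have hsum : ∑ i ∈ range (k + 1), (-1 : ℤ) ^ (k - i) * (k.choose i : ℤ) * (i : ℤ) ^ n =
      (Nat.stirlingSecond n k : ℤ) * k.factorial := by
    have h : ∀ i ∈ range (k + 1), (-1 : ℤ) ^ (k - i) * (k.choose i : ℤ) * (i : ℤ) ^ n =
        (-1) ^ k * ((-1 : ℤ) ^ i * (k.choose i : ℤ) * (i : ℤ) ^ n) := by
      intro i hi
      rw [neg_one_pow_sub_eq (Nat.lt_succ_iff.mp (mem_range.mp hi))]
      ring
    rw [sum_congr rfl h, ← mul_sum, sum_choose_mul_pow_eq, ← mul_assoc, ← mul_assoc, ← pow_add,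
      Even.neg_one_pow ⟨k, rfl⟩, one_mul, mul_comm]
  unfold stirling2
  rw [if_neg (by omega)]
  simp only [Int.toNat_natCast]
  rw [hsum, Int.mul_ediv_cancel _ (by exact_mod_cast k.factorial_ne_zero)]

/-- The polynomial `(1 - x)(1 - 2x)⋯(1 - kx)`. -/
noncomputable def denom (k : ℕ) : Polynomial ℤ :=
  ∏ i ∈ range k, (1 - ((i + 1 : ℕ) : Polynomial ℤ) * Polynomial.X)

/-- The power series `1 / ((1 - x)(1 - 2x)⋯(1 - kx))`, with Stirling numbers as coefficients. -/
noncomputable def stirlingSeries (k : ℕ) : PowerSeries ℤ :=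
  PowerSeries.mk fun m => (Nat.stirlingSecond (k + m) k : ℤ)

theorem one_sub_mul_stirlingSeries (k : ℕ) :
    (1 - ((k + 1 : ℕ) : PowerSeries ℤ) * X) * stirlingSeries (k + 1) = stirlingSeries k := by
  ext m
  rw [sub_mul, one_mul, mul_assoc, map_sub, ← map_natCast (C (R := ℤ)), coeff_C_mul]
  cases m with
  | zero => simp [stirlingSeries, Nat.stirlingSecond_self]
  | succ m =>
    rw [coeff_succ_X_mul]
    simp only [stirlingSeries, coeff_mk]
    rw [show k + 1 + (m + 1) = (k + m + 1) + 1 by ring, Nat.stirlingSecond_succ_succ,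
      show k + 1 + m = k + m + 1 by ring, show k + (m + 1) = k + m + 1 by ring]
    push_cast
    ring

theorem coe_natCast (k : ℕ) : ((k : Polynomial ℤ) : PowerSeries ℤ) = (k : PowerSeries ℤ) :=
  map_natCast (Polynomial.coeToPowerSeries.ringHom (R := ℤ)) k

theorem denom_mul_stirlingSeries (k : ℕ) :
    (denom k : PowerSeries ℤ) * stirlingSeries k = 1 := by
  induction k with
  | zero =>
    ext m
    cases m <;> simp [denom, stirlingSeries, coeff_one]
  | succ k ih =>
    have h : (denom (k + 1) : PowerSeries ℤ) =
        (denom k : PowerSeries ℤ) * (1 - ((k + 1 : ℕ) : PowerSeries ℤ) * X) := by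
      rw [denom, prod_range_succ, ← denom, Polynomial.coe_mul, Polynomial.coe_sub,
        Polynomial.coe_mul, coe_natCast, Polynomial.coe_one, Polynomial.coe_X]
    rw [h, mul_assoc, one_sub_mul_stirlingSeries, ih]

theorem stirlingSecond_eq_coeff (n k : ℕ) :
    (Nat.stirlingSecond (k + n) (k + 1) : ℤ) = coeff n (X * stirlingSeries (k + 1)) := by
  cases n with
  | zero => simp [Nat.stirlingSecond_eq_zero_of_lt]
  | succ n =>
    rw [coeff_succ_X_mul, stirlingSeries, coeff_mk]
    congr 2
    ring

/-- The power series `(1 - x ^ q) ^ (-B)`. -/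
noncomputable def negPow (q B : ℕ) : PowerSeries ℤ :=
  PowerSeries.mk fun n => if q ∣ n then (Nat.multichoose B (n / q) : ℤ) else 0

theorem one_sub_mul_negPow {q : ℕ} (hq : 0 < q) (B : ℕ) :
    (1 - X ^ q) * negPow q (B + 1) = negPow q B := by
  ext n
  rw [sub_mul, one_mul, map_sub, coeff_X_pow_mul']
  simp only [negPow, coeff_mk]
  by_cases hn : q ∣ n
  · obtain ⟨t, rfl⟩ := hn
    cases t with
    | zero => simp [hq.ne']
    | succ t =>
      have h : q * (t + 1) - q = q * t := by rw [mul_add, mul_one, Nat.add_sub_cancel]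
      rw [h, if_pos (Nat.le_mul_of_pos_right q t.succ_pos)]
      simp [Nat.mul_div_cancel_left _ hq, Nat.multichoose_succ_succ]
  · rw [if_neg hn, if_neg hn]
    split_ifs with h1 h2
    · exact absurd ((Nat.dvd_sub_iff_left h1 dvd_rfl).mp h2) hn
    · simp
    · simp

theorem one_sub_pow_mul_negPow {q : ℕ} (hq : 0 < q) (B : ℕ) :
    (1 - X ^ q) ^ B * negPow q B = 1 := by
  induction B with
  | zero =>
    ext n
    rw [pow_zero, one_mul, negPow, coeff_mk, coeff_one]
    by_cases hn : q ∣ n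
    · obtain ⟨t, rfl⟩ := hn
      rw [Nat.mul_div_cancel_left _ hq]
      cases t <;> simp [hq.ne']
    · rw [if_neg hn, if_neg]
      rintro rfl
      exact hn (dvd_zero q)
  | succ B ih => rw [pow_succ, mul_assoc, one_sub_mul_negPow hq, ih]

theorem dvd_sub_of_mul_eq_one {R : Type*} [CommRing R] {m u v U V : R}
    (hu : u * U = 1) (hv : v * V = 1) (h : m ∣ u - v) : m ∣ U - V := by
  obtain ⟨w, hw⟩ := h
  refine ⟨-(w * U * V), ?_⟩
  linear_combination (-U * V) * hw + V * hu - U * hv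

theorem natCast_dvd_coeff {m : ℕ} {f : PowerSeries ℤ} (h : (m : PowerSeries ℤ) ∣ f) (n : ℕ) :
    (m : ℤ) ∣ coeff n f := by
  obtain ⟨g, rfl⟩ := h
  rw [← map_natCast (C (R := ℤ)), coeff_C_mul]
  exact dvd_mul_right _ _

theorem partialStirling_eq (p d : ℕ) : partialStirling p d (d + 1) =
    ((-1) ^ (d + 1) / (d + 1).factorial) * ((∑ i ∈ range (d + 1 + 1),
      if ¬ p ∣ i then (-1) ^ i * ((d + 1).choose i : ℤ) * i ^ d else 0 : ℤ) : ℚ) := by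
  rw [partialStirling, Int.cast_sum]
  congr 1
  refine sum_congr rfl fun i _ => ?_
  split_ifs <;> simp

theorem stirlingLike_of_lt (i c : ℕ) {d : ℤ} (h : d < i) : stirlingLike i c d = 0 := by
  induction c generalizing d with
  | zero =>
    rw [stirlingLike, if_neg (fun h' : (0 : ℤ) = (i : ℤ) - 1 ∧ d = (i : ℤ) => h.ne h'.2), ite_self]
  | succ c ih =>
    rw [stirlingLike, ih h, ih (by omega),
      if_neg (fun h' : (c : ℤ) + 1 = (i : ℤ) - 1 ∧ d = (i : ℤ) => h.ne h'.2)]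
    simp

theorem stirlingLike_diagonal (i d : ℕ) :
    stirlingLike i d ((d + 1 : ℕ) : ℤ) = if i = d + 1 then 1 else 0 := by
  cases d with
  | zero =>
    rw [stirlingLike]
    split_ifs <;> first | rfl | omega
  | succ d =>
    rw [stirlingLike]
    split_ifs <;> first | rfl | omega

theorem stirlingLike_succ_succ (i : ℕ) {c d : ℕ} (h : d ≤ c) :
    stirlingLike i (c + 1) ((d + 1 : ℕ) : ℤ) =
      (d + 1 : ℕ) * stirlingLike i c ((d + 1 : ℕ) : ℤ) + stirlingLike i c (d : ℤ) := by
  rw [stirlingLike, if_neg (by omega), if_neg (by omega)]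
  simp

/-- The factor by which the limit of `S(p ^ e * a + c, p ^ e * b + d)` differs from that of
`S(p ^ e * a, p ^ e * b)`, with `w` in place of `p / (p - 1) * ((a - b) / b)`. -/
noncomputable def limitFactor (p : ℕ) (w : ℚ) (c d : ℕ) : ℚ :=
  Nat.stirlingSecond c d + ∑ i ∈ Icc 1 d, stirlingLike i c d * partialStirling p (i - 1) i * w

theorem limitFactor_zero (p : ℕ) (w : ℚ) (c : ℕ) :
    limitFactor p w c 0 = Nat.stirlingSecond c 0 := by
  simp [limitFactor]

theorem limitFactor_diagonal (p : ℕ) (w : ℚ) (d : ℕ) :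
    limitFactor p w d (d + 1) = partialStirling p d (d + 1) * w := by
  rw [limitFactor, Nat.stirlingSecond_eq_zero_of_lt d.lt_succ_self, Nat.cast_zero, zero_add,
    sum_eq_single (d + 1)]
  · rw [stirlingLike_diagonal, if_pos rfl]
    simp
  · intro i _ hi
    rw [stirlingLike_diagonal, if_neg hi]
    simp
  · simp

theorem limitFactor_succ_succ (p : ℕ) (w : ℚ) {c d : ℕ} (h : d ≤ c) :
    limitFactor p w (c + 1) (d + 1) =
      (d + 1) * limitFactor p w c (d + 1) + limitFactor p w c d := by
  have hext : ∑ i ∈ Icc 1 d, stirlingLike i c d * partialStirling p (i - 1) i * w =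
      ∑ i ∈ Icc 1 (d + 1), stirlingLike i c d * partialStirling p (i - 1) i * w := by
    rw [sum_Icc_succ_top (by omega), stirlingLike_of_lt (d + 1) c (by simp)]
    simp
  rw [limitFactor, limitFactor, limitFactor, hext, mul_add, mul_sum, add_add_add_comm,
    ← sum_add_distrib, Nat.stirlingSecond_succ_succ]
  congr 1
  · push_cast
    ring
  · refine sum_congr rfl fun i _ => ?_
    rw [stirlingLike_succ_succ i h]
    push_cast
    ring

theorem dvd_denom_mul_add_sub (M t s : ℕ) :
    (M : Polynomial ℤ) ∣ denom (M * t + s) - denom (M * t) * denom s := by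
  rw [denom, prod_range_add, ← denom, ← mul_sub]
  refine Dvd.dvd.mul_left ?_ _
  rw [← Ideal.mem_span_singleton, ← Ideal.Quotient.eq, denom, map_prod, map_prod]
  refine prod_congr rfl fun i _ => ?_
  have hM : Ideal.Quotient.mk (Ideal.span {(M : Polynomial ℤ)}) (M : Polynomial ℤ) = 0 :=
    Ideal.Quotient.eq_zero_iff_mem.mpr (Ideal.mem_span_singleton_self _)
  push_cast
  simp only [map_sub, map_mul, map_add, hM, zero_mul, zero_add]

theorem dvd_denom_mul_sub_pow (M t : ℕ) :
    (M : Polynomial ℤ) ∣ denom (M * t) - denom M ^ t := by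
  induction t with
  | zero => simp [denom]
  | succ t ih =>
    rw [pow_succ, mul_add, mul_one]
    simpa [sub_mul] using dvd_add (dvd_denom_mul_add_sub M t M) (ih.mul_right (denom M))

theorem dvd_stirlingSeries_sub_mul (M t s : ℕ) : (M : PowerSeries ℤ) ∣
    stirlingSeries (M * t + s) - stirlingSeries (M * t) * stirlingSeries s := by
  refine dvd_sub_of_mul_eq_one 
    (v := (denom (M * t) : PowerSeries ℤ) * (denom s : PowerSeries ℤ))
    (denom_mul_stirlingSeries _) ?_ ?_
  · rw [mul_mul_mul_comm, denom_mul_stirlingSeries, denom_mul_stirlingSeries, one_mul]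
  · simpa [coe_natCast] using map_dvd (Polynomial.coeToPowerSeries.ringHom (R := ℤ))
      (dvd_denom_mul_add_sub M t s)

variable {p : ℕ} [hp : Fact p.Prime]

theorem natCast_dvd_of_map_eq_zero {f : Polynomial ℤ}
    (h : f.map (Int.castRingHom (ZMod p)) = 0) : (p : Polynomial ℤ) ∣ f := by
  have : (p : Polynomial ℤ) = Polynomial.C (p : ℤ) := by simp
  rw [this, Polynomial.C_dvd_iff_dvd_coeff]
  intro i
  rw [← ZMod.intCast_zmod_eq_zero_iff_dvd]
  have := congrArg (fun g => Polynomial.coeff g i) h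
  simpa using this

theorem prod_one_sub_eq_one_sub_pow :
    ∏ i ∈ range (p - 1), (1 - ((i + 1 : ℕ) : Polynomial (ZMod p)) * Polynomial.X) =
      1 - Polynomial.X ^ (p - 1) := by
  have hp2 := hp.out.two_le
  rw [← sub_eq_zero]
  apply Polynomial.eq_zero_of_natDegree_lt_card_of_eval_eq_zero _ (f := id) Function.injective_id
  · intro x
    rw [id, Polynomial.eval_sub, Polynomial.eval_prod]
    by_cases hx : x = 0
    · simp [hx, (show p - 1 ≠ 0 by omega)]
    · have hval : x⁻¹.val ≠ 0 := by simpa [ZMod.val_eq_zero] using hx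
      have hlt := ZMod.val_lt x⁻¹
      rw [prod_eq_zero (i := x⁻¹.val - 1) (mem_range.mpr (by omega))]
      · simp [ZMod.pow_card_sub_one_eq_one hx]
      · rw [Nat.sub_add_cancel (Nat.pos_of_ne_zero hval)]
        rw [Polynomial.eval_sub, Polynomial.eval_mul, Polynomial.eval_natCast, ZMod.natCast_zmod_val]
        simp [hx]
  · rw [ZMod.card]
    refine lt_of_le_of_lt (b := p - 1) ?_ (by omega)
    refine (Polynomial.natDegree_sub_le _ _).trans (max_le ?_ ?_)
    · refine (Polynomial.natDegree_prod_le _ _).trans ?_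
      refine (sum_le_card_nsmul _ _ 1 fun i _ => ?_).trans (by simp)
      compute_degree
    · compute_degree

theorem prime_dvd_denom_sub :
    (p : Polynomial ℤ) ∣ denom p - (1 - Polynomial.X ^ (p - 1)) := by
  apply natCast_dvd_of_map_eq_zero
  have hdenom : denom p = denom (p - 1) * (1 - (p : Polynomial ℤ) * Polynomial.X) := by
    have := hp.out.pos
    conv_lhs => rw [← Nat.sub_add_cancel this]
    rw [denom, prod_range_succ, ← denom, Nat.sub_add_cancel this]
  rw [hdenom, Polynomial.map_sub, Polynomial.map_mul, denom, Polynomial.map_prod]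
  have := prod_one_sub_eq_one_sub_pow (p := p)
  push_cast at this
  simp [this]

theorem dvd_denom_sub_pow {e f : ℕ} (hf : 2 * f ≤ e) (b : ℕ) :
    (p : Polynomial ℤ) ^ (f + 1) ∣
      denom (p ^ (e + 1) * b) - (1 - Polynomial.X ^ (p - 1)) ^ (p ^ e * b) := by
  have h1 : (p : Polynomial ℤ) ^ (f + 1) ∣
      denom (p ^ (e + 1) * b) - denom (p ^ (f + 1)) ^ (p ^ (e - f) * b) := by
    have h := dvd_denom_mul_sub_pow (p ^ (f + 1)) (p ^ (e - f) * b)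
    rwa [← mul_assoc, ← pow_add, show f + 1 + (e - f) = e + 1 by omega, Nat.cast_pow] at h
  have h2 : (p : Polynomial ℤ) ∣
      denom (p ^ (f + 1)) - (1 - Polynomial.X ^ (p - 1)) ^ p ^ f := by
    have h := dvd_add (dvd_denom_mul_sub_pow p (p ^ f))
      ((prime_dvd_denom_sub (p := p)).trans (sub_dvd_pow_sub_pow _ _ (p ^ f)))
    rwa [sub_add_sub_cancel, ← pow_succ'] at h
  have h3 : (p : Polynomial ℤ) ^ (f + 1) ∣ denom (p ^ (f + 1)) ^ (p ^ (e - f) * b) -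
      (1 - Polynomial.X ^ (p - 1)) ^ (p ^ e * b) := by
    have h := ((pow_dvd_pow _ (show f + 1 ≤ e - f + 1 by omega)).trans
      (dvd_sub_pow_of_dvd_sub h2 (e - f))).trans
      (sub_dvd_pow_sub_pow _ _ b)
    rwa [← pow_mul, ← pow_mul, ← pow_mul, ← mul_assoc, ← pow_add,
      show f + (e - f) = e by omega] at h
  simpa using dvd_add h1 h3

theorem dvd_stirlingSeries_sub_negPow {e f : ℕ} (hf : 2 * f ≤ e) (b : ℕ) :
    ((p ^ (f + 1) : ℕ) : PowerSeries ℤ) ∣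
      stirlingSeries (p ^ (e + 1) * b) - negPow (p - 1) (p ^ e * b) := by
  refine dvd_sub_of_mul_eq_one (denom_mul_stirlingSeries _)
    (one_sub_pow_mul_negPow (Nat.sub_pos_of_lt hp.out.one_lt) _) ?_
  simpa [coe_natCast] using map_dvd (Polynomial.coeToPowerSeries.ringHom (R := ℤ))
    (dvd_denom_sub_pow (p := p) hf b)

theorem dvd_one_sub_pow_sub (e b : ℕ) : (p : PowerSeries ℤ) ^ (e + 1) ∣
    (1 - X ^ 1) ^ (p ^ (e + 1) * b) - (1 - X ^ p) ^ (p ^ e * b) := by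
  have h : (p : PowerSeries ℤ) ∣ (1 - X) ^ p - (1 - X ^ p) := by
    obtain ⟨r, hr⟩ := exists_add_pow_prime_eq hp.out (1 - X : PowerSeries ℤ) X
    rw [sub_add_cancel, one_pow] at hr
    exact ⟨-((1 - X) * X * r), by linear_combination -hr⟩
  have h' := (dvd_sub_pow_of_dvd_sub h e).trans (sub_dvd_pow_sub_pow _ _ b)
  rwa [← pow_mul, ← pow_mul, ← pow_mul, ← mul_assoc, ← pow_succ', ← pow_one X, ← pow_mul,
    one_mul] at h'

theorem dvd_multichoose_sub (e b m : ℕ) : (p : ℤ) ^ (e + 1) ∣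
    (Nat.multichoose (p ^ (e + 1) * b) (p * m) : ℤ) - Nat.multichoose (p ^ e * b) m := by
  have h : ((p ^ (e + 1) : ℕ) : PowerSeries ℤ) ∣
      negPow 1 (p ^ (e + 1) * b) - negPow p (p ^ e * b) := by
    refine dvd_sub_of_mul_eq_one (one_sub_pow_mul_negPow one_pos _)
      (one_sub_pow_mul_negPow hp.out.pos _) ?_
    simpa using dvd_one_sub_pow_sub (p := p) e b
  simpa [negPow, Nat.mul_div_cancel_left _ hp.out.pos] using natCast_dvd_coeff h (p * m)

theorem succ_mul_multichoose (B j : ℕ) :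
    (j + 1) * Nat.multichoose B (j + 1) = B * Nat.multichoose (B + 1) j := by
  rw [Nat.multichoose_eq, Nat.multichoose_eq, mul_comm, ← add_assoc, Nat.add_sub_cancel,
    Nat.choose_succ_right_eq, Nat.add_sub_cancel, add_right_comm, Nat.add_sub_cancel, mul_comm]

theorem mul_sum_multichoose (B m : ℕ) :
    B * ∑ j ∈ range m, Nat.multichoose B j = m * Nat.multichoose B m := by
  have hsum : ∀ m, ∑ j ∈ range (m + 1), Nat.multichoose B j = Nat.multichoose (B + 1) m := by
    intro m
    induction m with
    | zero => simp
    | succ m ih => rw [sum_range_succ, ih, Nat.multichoose_succ_succ, add_comm]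
  cases m with
  | zero => simp
  | succ m => rw [hsum, succ_mul_multichoose]

theorem coeff_negPow_mul {q : ℕ} (hq : 0 < q) (B m : ℕ) (f : PowerSeries ℤ) :
    coeff (q * m) (negPow q B * f) =
      ∑ j ∈ range (m + 1), (Nat.multichoose B j : ℤ) * coeff (q * (m - j)) f := by
  rw [coeff_mul, Nat.sum_antidiagonal_eq_sum_range_succ_mk]
  symm
  refine sum_of_injOn (fun j => q * j) ?_ ?_ ?_ ?_
  · intro x _ y _ h
    exact Nat.eq_of_mul_eq_mul_left hq h
  · intro j hj
    simp only [coe_range, Set.mem_Iio, Nat.lt_succ_iff] at hj ⊢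
    exact Nat.mul_le_mul_left q hj
  · intro n hn hn'
    have : ¬ q ∣ n := by
      rintro ⟨j, rfl⟩
      refine hn' ⟨j, ?_, rfl⟩
      simp only [coe_range, Set.mem_Iio, mem_range, Nat.lt_succ_iff] at hn ⊢
      exact Nat.le_of_mul_le_mul_left hn hq
    simp [negPow, this]
  · intro j _
    simp [negPow, Nat.mul_div_cancel_left _ hq, Nat.mul_sub]

theorem pow_dvd_pow_sub_ite {r t : ℕ} (ht : t ≠ 0) (h : p ^ r ∣ t) (i : ℕ) :
    (p : ℤ) ^ r ∣ (i : ℤ) ^ ((p - 1) * t) - if ¬ p ∣ i then 1 else 0 := by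
  by_cases hi : p ∣ i
  · have hr : r ≤ (p - 1) * t :=
      (((Nat.lt_pow_self hp.out.one_lt).le).trans (Nat.le_of_dvd (Nat.pos_of_ne_zero ht) h)).trans
        (Nat.le_mul_of_pos_left t (Nat.sub_pos_of_lt hp.out.one_lt))
    simpa [hi] using (pow_dvd_pow (p : ℤ) hr).trans
      (pow_dvd_pow_of_dvd (Int.natCast_dvd_natCast.mpr hi) _)
  · obtain ⟨s, rfl⟩ := h
    have hfermat : (p : ℤ) ∣ (i : ℤ) ^ (p - 1) - 1 := by
      have hcop : IsCoprime (i : ℤ) p :=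
        Nat.isCoprime_iff_coprime.mpr ((Nat.Prime.coprime_iff_not_dvd hp.out).mpr hi).symm
      exact (Int.ModEq.pow_card_sub_one_eq_one hp.out hcop).symm.dvd
    have h1 := ((pow_dvd_pow (p : ℤ) r.le_succ).trans (dvd_sub_pow_of_dvd_sub hfermat r)).trans
      (sub_dvd_pow_sub_pow _ _ s)
    simpa [hi, ← pow_mul, mul_assoc] using h1

theorem pow_dvd_multichoose_mul {g B j t : ℕ} (ht : t ≠ 0) (hB : p ^ g ∣ B)
    (hjt : p ^ g ∣ j + t) (i : ℕ) : (p : ℤ) ^ g ∣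
      Nat.multichoose B j * ((i : ℤ) ^ ((p - 1) * t) - if ¬ p ∣ i then 1 else 0) := by
  by_cases hg : p ^ g ∣ t
  · exact (pow_dvd_pow_sub_ite ht hg i).mul_left _
  obtain ⟨r, s, hs, hrs⟩ := Nat.exists_eq_pow_mul_and_not_dvd ht p hp.out.ne_one
  have hrg : r < g := by
    by_contra! h
    exact hg (hrs ▸ (pow_dvd_pow p h).mul_right s)
  obtain ⟨u, rfl⟩ := Nat.exists_eq_add_of_lt hrg
  have hj : p ^ r ∣ j := by
    refine (Nat.dvd_add_iff_left (⟨s, hrs⟩ : p ^ r ∣ t)).mpr ((pow_dvd_pow p ?_).trans hjt)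
    omega
  obtain ⟨k, rfl⟩ := hj
  have hr0 : 0 < p ^ r := pow_pos hp.out.pos r
  rw [hrs, ← mul_add, add_assoc, pow_add] at hjt
  have hk : ¬ p ∣ k := by
    intro hk
    have := (dvd_pow_self p u.succ_ne_zero).trans (Nat.dvd_of_mul_dvd_mul_left hr0 hjt)
    exact hs ((Nat.dvd_add_right hk).mp this)
  have hmul : p ^ (r + (u + 1)) ∣ p ^ r * k * Nat.multichoose B (p ^ r * k) := by
    cases hv : p ^ r * k with
    | zero => simp
    | succ v => exact succ_mul_multichoose B v ▸ hB.mul_right _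
  rw [pow_add, mul_assoc] at hmul
  have hmc : p ^ (u + 1) ∣ Nat.multichoose B (p ^ r * k) :=
    (((Nat.Prime.coprime_iff_not_dvd hp.out).mpr hk).pow_left _).dvd_of_dvd_mul_left
      (Nat.dvd_of_mul_dvd_mul_left hr0 hmul)
  rw [add_assoc, add_comm, pow_add]
  exact mul_dvd_mul (by exact_mod_cast hmc) (pow_dvd_pow_sub_ite ht ⟨s, hrs⟩ i)

theorem dvd_coeff_negPow_mul_sub {g B m : ℕ} (hB : p ^ g ∣ B) (hm : p ^ g ∣ m) (d : ℕ) :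
    (p : ℤ) ^ g ∣ (-1) ^ (d + 1) * (d + 1).factorial *
        coeff ((p - 1) * m) (negPow (p - 1) B * (X * stirlingSeries (d + 1))) -
      (∑ i ∈ range (d + 1 + 1), if ¬ p ∣ i then (-1) ^ i * ((d + 1).choose i : ℤ) * i ^ d else 0) *
        ∑ j ∈ range m, (Nat.multichoose B j : ℤ) := by
  have hcoeff : (-1) ^ (d + 1) * (d + 1).factorial *
        coeff ((p - 1) * m) (negPow (p - 1) B * (X * stirlingSeries (d + 1))) =
      ∑ j ∈ range m, ∑ i ∈ range (d + 1 + 1), (-1) ^ i * ((d + 1).choose i : ℤ) * i ^ d *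
        (Nat.multichoose B j * (i : ℤ) ^ ((p - 1) * (m - j))) := by
    rw [coeff_negPow_mul (Nat.sub_pos_of_lt hp.out.one_lt), sum_range_succ, mul_add, mul_sum]
    simp only [← stirlingSecond_eq_coeff]
    rw [Nat.stirlingSecond_eq_zero_of_lt (n := d + (p - 1) * (m - m)) (by simp)]
    simp only [Nat.cast_zero, mul_zero, add_zero]
    refine sum_congr rfl fun j _ => ?_
    rw [mul_left_comm, ← sum_choose_mul_pow_eq, mul_sum]
    refine sum_congr rfl fun i _ => ?_
    ring
  rw [hcoeff, mul_sum, ← sum_sub_distrib]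
  refine dvd_sum fun j hj => ?_
  rw [sum_mul, ← sum_sub_distrib]
  refine dvd_sum fun i _ => ?_
  have hj := mem_range.mp hj
  have h := (pow_dvd_multichoose_mul (p := p) (g := g) (B := B) (j := j) (t := m - j) (by omega) hB
    (by rwa [Nat.add_sub_cancel' hj.le]) i).mul_left ((-1) ^ i * ((d + 1).choose i : ℤ) * i ^ d)
  convert h using 1
  split_ifs <;> ring

theorem tendsto_intCast_sub_zero {u v : ℕ → ℤ} {r : ℕ → ℕ} (hr : Filter.Tendsto r .atTop .atTop)
    (h : ∀ e, (p : ℤ) ^ r e ∣ u e - v e) :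
    Filter.Tendsto (fun e => (u e : ℚ_[p]) - (v e : ℚ_[p])) .atTop (nhds 0) := by
  have hp0 : Filter.Tendsto (fun e => ((p : ℝ)⁻¹) ^ r e) .atTop (nhds 0) :=
    (tendsto_pow_atTop_nhds_zero_of_lt_one (by positivity)
      (inv_lt_one_of_one_lt₀ (by exact_mod_cast hp.out.one_lt))).comp hr
  refine squeeze_zero_norm (fun e => ?_) hp0
  have := (Padic.norm_int_le_pow_iff_dvd (p := p) _ _).mpr (by exact_mod_cast h e)
  simpa using this

theorem tendsto_of_dvd_sub {u v : ℕ → ℤ} {r : ℕ → ℕ} (hr : Filter.Tendsto r .atTop .atTop)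
    (h : ∀ e, (p : ℤ) ^ r e ∣ u e - v e) {l : ℚ_[p]}
    (hv : Filter.Tendsto (fun e => (v e : ℚ_[p])) .atTop (nhds l)) :
    Filter.Tendsto (fun e => (u e : ℚ_[p])) .atTop (nhds l) := by
  simpa using (tendsto_intCast_sub_zero hr h).add hv

theorem exists_padicInt_tendsto {u : ℕ → ℤ} {l : ℚ_[p]}
    (h : Filter.Tendsto (fun e => (u e : ℚ_[p])) .atTop (nhds l)) :
    ∃ M : ℤ_[p], (M : ℚ_[p]) = l ∧
      Filter.Tendsto (fun e => (u e : ℤ_[p])) .atTop (nhds M) := by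
  have hl : ‖l‖ ≤ 1 := le_of_tendsto h.norm (.of_forall fun e => Padic.norm_int_le_one _)
  refine ⟨⟨l, hl⟩, rfl, tendsto_subtype_rng.mpr ?_⟩
  simpa using h

theorem tendsto_half : Filter.Tendsto (fun e : ℕ => e / 2) .atTop .atTop :=
  Nat.tendsto_div_const_atTop two_ne_zero

theorem exists_tendsto_multichoose (b m : ℕ) : ∃ L : ℚ_[p], Filter.Tendsto
    (fun e => (((Nat.multichoose (p ^ e * b) (p ^ (e + 1) * m) : ℕ) : ℤ) : ℚ_[p]))
    .atTop (nhds L) := by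
  refine cauchySeq_tendsto_of_complete (cauchySeq_of_le_geometric (p : ℝ)⁻¹ 1
    (inv_lt_one_of_one_lt₀ (by exact_mod_cast hp.out.one_lt)) fun e => ?_)
  have h := (pow_dvd_pow (p : ℤ) e.le_succ).trans (dvd_multichoose_sub e b (p ^ (e + 1) * m))
  rw [← mul_assoc, ← pow_succ'] at h
  have := (Padic.norm_int_le_pow_iff_dvd (p := p) _ _).mpr (by exact_mod_cast h)
  rw [dist_comm, dist_eq_norm]
  simpa using this

theorem tendsto_multichoose_shift (b m : ℕ) {s : ℕ} (hs : s ≠ 0) : Filter.Tendsto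
    (fun e => (((Nat.multichoose (p ^ e * b) (p ^ (e + 1) * m + s) : ℕ) : ℤ) : ℚ_[p]))
    .atTop (nhds 0) := by
  obtain ⟨s, rfl⟩ := Nat.exists_eq_add_one_of_ne_zero hs
  have hden : Filter.Tendsto (fun e => (((p ^ (e + 1) * m + (s + 1) : ℕ) : ℤ) : ℚ_[p]))
      .atTop (nhds (((s + 1 : ℕ) : ℤ) : ℚ_[p])) := by
    refine tendsto_of_dvd_sub (v := fun _ => ((s + 1 : ℕ) : ℤ)) Filter.tendsto_id (fun e => ?_)
      tendsto_const_nhds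
    simp [pow_succ, mul_assoc]
  have hnum := tendsto_of_dvd_sub (p := p) (v := fun _ => 0)
    (u := fun e => ((p ^ e * b * Nat.multichoose (p ^ e * b + 1) (p ^ (e + 1) * m + s) : ℕ) : ℤ))
    Filter.tendsto_id (fun e => by simp [mul_assoc]) (l := 0) (by simp)
  have h := hnum.div hden (by exact_mod_cast s.succ_ne_zero)
  rw [zero_div] at h
  refine h.congr fun e => ?_
  simp only [Pi.div_apply]
  rw [← succ_mul_multichoose]
  have h0 : (((p ^ (e + 1) * m + (s + 1) : ℕ) : ℤ) : ℚ_[p]) ≠ 0 := by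
    exact_mod_cast (Nat.succ_ne_zero (p ^ (e + 1) * m + s))
  rw [div_eq_iff h0]
  simp only [add_assoc]
  push_cast
  ring

variable {b m : ℕ} {L : ℚ_[p]}

theorem tendsto_stirlingSecond_zero (hL : Filter.Tendsto
      (fun e => (((Nat.multichoose (p ^ e * b) (p ^ (e + 1) * m) : ℕ) : ℤ) : ℚ_[p]))
      .atTop (nhds L)) (c : ℕ) : Filter.Tendsto
    (fun e => ((Nat.stirlingSecond (p ^ (e + 1) * (b + (p - 1) * m) + c) (p ^ (e + 1) * b) : ℤ) :
      ℚ_[p])) .atTop (nhds (L * Nat.stirlingSecond c 0)) := by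
  have hq : 0 < p - 1 := Nat.sub_pos_of_lt hp.out.one_lt
  have hcongr : ∀ e, (p : ℤ) ^ (e / 2) ∣
      (Nat.stirlingSecond (p ^ (e + 1) * (b + (p - 1) * m) + c) (p ^ (e + 1) * b) : ℤ) -
        coeff ((p - 1) * (p ^ (e + 1) * m) + c) (negPow (p - 1) (p ^ e * b)) := by
    intro e
    have h := natCast_dvd_coeff (dvd_stirlingSeries_sub_negPow (p := p) (Nat.mul_div_le e 2) b)
      ((p - 1) * (p ^ (e + 1) * m) + c)
    rw [map_sub, stirlingSeries, coeff_mk, ← add_assoc, mul_left_comm (p - 1), ← mul_add,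
      Nat.cast_pow] at h
    rw [mul_left_comm (p - 1)]
    exact (pow_dvd_pow _ (Nat.le_succ _)).trans h
  refine tendsto_of_dvd_sub tendsto_half hcongr ?_
  simp only [negPow, coeff_mk]
  by_cases hc : p - 1 ∣ c
  · obtain ⟨s, rfl⟩ := hc
    simp only [← mul_add, dvd_mul_right, if_true, Nat.mul_div_cancel_left _ hq]
    cases s with
    | zero => simpa using hL
    | succ s =>
      rw [mul_add, mul_one, show (p - 1) * s + (p - 1) = ((p - 1) * s + (p - 1) - 1) + 1 by omega,
        Nat.stirlingSecond_succ_zero]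
      simpa using tendsto_multichoose_shift b m s.succ_ne_zero
  · have hc' : ∀ e, ¬ p - 1 ∣ (p - 1) * (p ^ (e + 1) * m) + c := fun e =>
      fun h => hc ((Nat.dvd_add_right (dvd_mul_right _ _)).mp h)
    obtain ⟨c, rfl⟩ := Nat.exists_eq_succ_of_ne_zero (fun h : c = 0 => hc (h ▸ dvd_zero _))
    simp [hc']

theorem dvd_stirlingSecond_sub_coeff (b m e d : ℕ) : (p : ℤ) ^ (e / 2) ∣
    (Nat.stirlingSecond (p ^ (e + 1) * (b + (p - 1) * m) + d) (p ^ (e + 1) * b + (d + 1)) : ℤ) -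
      coeff ((p - 1) * (p ^ (e + 1) * m))
        (negPow (p - 1) (p ^ e * b) * (X * stirlingSeries (d + 1))) := by
  have h1 := dvd_stirlingSeries_sub_mul (p ^ (e / 2 + 1)) (p ^ (e - e / 2) * b) (d + 1)
  rw [← mul_assoc, ← pow_add, show e / 2 + 1 + (e - e / 2) = e + 1 by omega] at h1
  have h2 := (dvd_stirlingSeries_sub_negPow (p := p) (Nat.mul_div_le e 2) b).mul_right
    (stirlingSeries (d + 1))
  have h3 := natCast_dvd_coeff ((dvd_add h1 h2).mul_left X) ((p - 1) * (p ^ (e + 1) * m))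
  have h4 : X * (stirlingSeries (p ^ (e + 1) * b + (d + 1)) -
        stirlingSeries (p ^ (e + 1) * b) * stirlingSeries (d + 1) +
        (stirlingSeries (p ^ (e + 1) * b) - negPow (p - 1) (p ^ e * b)) *
          stirlingSeries (d + 1)) =
      X * stirlingSeries (p ^ (e + 1) * b + d + 1) -
        negPow (p - 1) (p ^ e * b) * (X * stirlingSeries (d + 1)) := by
    rw [← add_assoc]
    ring
  rw [h4, map_sub, ← stirlingSecond_eq_coeff, Nat.cast_pow] at h3
  have h5 : p ^ (e + 1) * (b + (p - 1) * m) + d =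
      p ^ (e + 1) * b + d + (p - 1) * (p ^ (e + 1) * m) := by ring
  rw [h5, ← add_assoc]
  exact (pow_dvd_pow _ (Nat.le_succ _)).trans h3

theorem tendsto_stirlingSecond_diagonal (hb : b ≠ 0) (hL : Filter.Tendsto
      (fun e => (((Nat.multichoose (p ^ e * b) (p ^ (e + 1) * m) : ℕ) : ℤ) : ℚ_[p]))
      .atTop (nhds L)) (d : ℕ) : Filter.Tendsto
    (fun e => ((Nat.stirlingSecond (p ^ (e + 1) * (b + (p - 1) * m) + d)
      (p ^ (e + 1) * b + (d + 1)) : ℤ) : ℚ_[p])) .atTop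
    (nhds (L * ((partialStirling p d (d + 1) * (p * m / b) : ℚ) : ℚ_[p]))) := by
  set τ : ℤ := ∑ i ∈ range (d + 1 + 1),
    if ¬ p ∣ i then (-1) ^ i * ((d + 1).choose i : ℤ) * i ^ d else 0 with hτ
  have hb' : (b : ℚ_[p]) ≠ 0 := by exact_mod_cast hb
  have hfac : ((d + 1).factorial : ℚ_[p]) ≠ 0 := by exact_mod_cast (d + 1).factorial_ne_zero
  have hsum : ∀ e, ((∑ j ∈ range (p ^ (e + 1) * m), (Nat.multichoose (p ^ e * b) j : ℤ) : ℤ) :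
      ℚ_[p]) = (p * m / b) * ((Nat.multichoose (p ^ e * b) (p ^ (e + 1) * m) : ℕ) : ℤ) := by
    intro e
    have h := congrArg (Nat.cast (R := ℚ_[p])) (mul_sum_multichoose (p ^ e * b) (p ^ (e + 1) * m))
    have hpe : (p : ℚ_[p]) ^ e ≠ 0 := pow_ne_zero _ (by exact_mod_cast hp.out.ne_zero)
    push_cast at h ⊢
    apply mul_left_cancel₀ (mul_ne_zero hpe hb')
    rw [h, pow_succ]
    field_simp
  have hdvd : ∀ e, (p : ℤ) ^ (e / 2) ∣ (-1) ^ (d + 1) * (d + 1).factorial *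
      (Nat.stirlingSecond (p ^ (e + 1) * (b + (p - 1) * m) + d) (p ^ (e + 1) * b + (d + 1)) : ℤ) -
      τ * ∑ j ∈ range (p ^ (e + 1) * m), (Nat.multichoose (p ^ e * b) j : ℤ) := by
    intro e
    have h1 := (dvd_stirlingSecond_sub_coeff (p := p) b m e d).mul_left
      ((-1) ^ (d + 1) * (d + 1).factorial)
    have h2 := (pow_dvd_pow (p : ℤ) (Nat.div_le_self e 2)).trans
      (dvd_coeff_negPow_mul_sub (p := p) (g := e) (B := p ^ e * b) (m := p ^ (e + 1) * m)
        (dvd_mul_right _ _) ((pow_dvd_pow p e.le_succ).mul_right m) d)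
    rw [mul_sub] at h1
    have h3 := dvd_add h1 h2
    rwa [sub_add_sub_cancel] at h3
  have hlim : Filter.Tendsto (fun e =>
      ((τ * ∑ j ∈ range (p ^ (e + 1) * m), (Nat.multichoose (p ^ e * b) j : ℤ) : ℤ) : ℚ_[p]))
      .atTop (nhds (τ * ((p * m / b) * L))) := by
    simp only [Int.cast_mul, hsum]
    exact (hL.const_mul _).const_mul _
  have h := (tendsto_of_dvd_sub tendsto_half hdvd hlim).const_mul
    ((-1) ^ (d + 1) / ((d + 1).factorial : ℚ_[p]))
  have hsq : ((-1 : ℚ_[p]) ^ (d + 1)) * (-1) ^ (d + 1) = 1 := by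
    rw [← mul_pow]
    simp
  convert h using 2
  · push_cast
    field_simp
    linear_combination (-(Nat.stirlingSecond _ _ : ℚ_[p])) * hsq
  · rw [partialStirling_eq, ← hτ]
    push_cast
    ring

theorem tendsto_stirlingSecond (hb : b ≠ 0) (hL : Filter.Tendsto
      (fun e => (((Nat.multichoose (p ^ e * b) (p ^ (e + 1) * m) : ℕ) : ℤ) : ℚ_[p]))
      .atTop (nhds L)) (c d : ℕ) (hd : d ≤ c + 1) : Filter.Tendsto
    (fun e => ((Nat.stirlingSecond (p ^ (e + 1) * (b + (p - 1) * m) + c)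
      (p ^ (e + 1) * b + d) : ℤ) : ℚ_[p])) .atTop
    (nhds (L * (limitFactor p (p * m / b) c d : ℚ_[p]))) := by
  induction c generalizing d with
  | zero =>
    obtain rfl | rfl : d = 0 ∨ d = 0 + 1 := by omega
    · simpa [limitFactor_zero] using tendsto_stirlingSecond_zero hL 0
    · rw [limitFactor_diagonal]
      exact tendsto_stirlingSecond_diagonal hb hL 0
  | succ c ih =>
    cases d with
    | zero => simpa [limitFactor_zero] using tendsto_stirlingSecond_zero hL (c + 1)
    | succ d =>
      obtain hd' | rfl : d ≤ c ∨ d = c + 1 := by omega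
      · have hK : Filter.Tendsto (fun e => (((p ^ (e + 1) * b + (d + 1) : ℕ) : ℤ) : ℚ_[p]))
            .atTop (nhds (((d + 1 : ℕ) : ℤ) : ℚ_[p])) := by
          refine tendsto_of_dvd_sub (v := fun _ => ((d + 1 : ℕ) : ℤ)) Filter.tendsto_id
            (fun e => ?_) tendsto_const_nhds
          simp [pow_succ, mul_assoc]
        have h := (hK.mul (ih (d + 1) (by omega))).add (ih d (by omega))
        convert h using 2
        · simp only [← add_assoc, Nat.stirlingSecond_succ_succ]
          push_cast
          ring
        · rw [limitFactor_succ_succ p _ hd']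
          push_cast
          ring
      · rw [limitFactor_diagonal]
        exact tendsto_stirlingSecond_diagonal hb hL (c + 1)

end PadicStirling

end

theorem padic_limit_stirling2_general_c_d (p : ℕ) [Fact p.Prime] (a b c d : ℤ)
    (hb : 1 ≤ b) (hba : b ≤ a) (hab : Int.ModEq ((p : ℤ) - 1) a b)
    (hd : 1 ≤ d) (hc : d - 1 ≤ c) :
    ∃ L M : ℤ_[p],
      Filter.Tendsto
        (fun e : ℕ => ((stirling2 ((p : ℤ) ^ e * a) ((p : ℤ) ^ e * b) : ℤ) : ℤ_[p]))
        Filter.atTop (nhds L) ∧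
      Filter.Tendsto
        (fun e : ℕ =>
          ((stirling2 ((p : ℤ) ^ e * a + c) ((p : ℤ) ^ e * b + d) : ℤ) : ℤ_[p]))
        Filter.atTop (nhds M) ∧
      (M : ℚ_[p]) = (L : ℚ_[p]) *
        ((((stirling2 c d : ℚ) +
          ∑ i ∈ Finset.Icc 1 d.toNat,
            (stirlingLike i c.toNat d : ℚ) * partialStirling p (i - 1) i *
              ((p : ℚ) / ((p : ℚ) - 1)) * (((a : ℚ) - (b : ℚ)) / (b : ℚ)) : ℚ)) : ℚ_[p]) := by
  obtain ⟨k, hk⟩ := hab.symm.dvd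
  have hp2 : 2 ≤ p := (Fact.out : p.Prime).two_le
  lift b to ℕ using by omega
  have hk0 : 0 ≤ k := nonneg_of_mul_nonneg_right (a := (p : ℤ) - 1) (by omega) (by omega)
  lift k to ℕ using hk0
  lift c to ℕ using by omega
  lift d to ℕ using by omega
  have hb0 : b ≠ 0 := by omega
  have ha : a = ((b + (p - 1) * k : ℕ) : ℤ) := by
    push_cast [Nat.cast_sub (show 1 ≤ p by omega)]
    omega
  obtain ⟨L, hL⟩ := PadicStirling.exists_tendsto_multichoose (p := p) b k
  have hlim : ∀ c d : ℕ, d ≤ c + 1 → Filter.Tendsto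
      (fun e : ℕ => ((stirling2 ((p : ℤ) ^ e * a + c) ((p : ℤ) ^ e * b + d) : ℤ) : ℚ_[p]))
      Filter.atTop (nhds (L * (PadicStirling.limitFactor p (p * k / b) c d : ℚ_[p]))) := by
    intro c d hcd
    rw [← Filter.tendsto_add_atTop_iff_nat 1]
    refine (PadicStirling.tendsto_stirlingSecond hb0 hL c d hcd).congr fun e => ?_
    rw [← PadicStirling.stirling2_natCast, ha]
    push_cast
    rfl
  obtain ⟨L', hL', hlimL⟩ := PadicStirling.exists_padicInt_tendsto (hlim 0 0 (by omega))
  obtain ⟨M, hM, hlimM⟩ := PadicStirling.exists_padicInt_tendsto (hlim c d (by omega))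
  refine ⟨L', M, by simpa using hlimL, hlimM, ?_⟩
  have hw : (p : ℚ) / ((p : ℚ) - 1) * (((a : ℚ) - ((b : ℤ) : ℚ)) / ((b : ℤ) : ℚ)) =
      p * k / b := by
    have h1 : (a : ℚ) - ((b : ℤ) : ℚ) = ((p : ℚ) - 1) * k := by exact_mod_cast hk
    have h2 : (p : ℚ) - 1 ≠ 0 := by
      have : (2 : ℚ) ≤ p := by exact_mod_cast hp2
      linarith
    rw [h1, Int.cast_natCast]
    field_simp
  rw [hM, hL', PadicStirling.limitFactor_zero, Nat.stirlingSecond_zero]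
  simp only [mul_assoc, hw]
  simp only [PadicStirling.limitFactor, PadicStirling.stirling2_natCast, Int.toNat_natCast,
    mul_assoc]
  simp
end
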